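/- Let p > 2 be a prime and let K be a field of characteristic zero equipped with an additive valuation v : K → ℤ ∪ {∞} normalized so that v(p) = 1. Let (a_m)_{m≥0} be a sequence in K with v(a_m) ≥ 0 for all m and v(a_m) = 0 for at least one m. Set c_0 := a_0 and c_m := a_m · p^m / m for m ≥ 1, and define I := min{ m ≥ 0 : v(a_m) = 0 } and J := min{ m ≥ 0 : v(c_ℓ) > v(c_m) for all ℓ > m } (this minimum exists). If I < p² − 2 and p does not divide I + 1, then J ≤ I. -/

import Mathlib

theorem aux_nat {K : Type*} [Field K] (v : AddValuation K (WithTop ℤ)) (n : ℕ) :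
    0 ≤ v (n : K) := by
  induction n with
  | zero => simp
  | succ k ih =>
    push_cast
    exact v.map_le_add ih (by simp)

theorem aux_int {K : Type*} [Field K] (v : AddValuation K (WithTop ℤ)) (n : ℤ) :
    0 ≤ v (n : K) := by
  obtain ⟨k, rfl | rfl⟩ := n.eq_nat_or_neg
  · simpa using aux_nat v k
  · simpa using aux_nat v k

theorem aux_cop {K : Type*} [Field K] (v : AddValuation K (WithTop ℤ)) (p n : ℕ)
    (hp : p.Prime) (hvp : v (p : K) = 1) (h : ¬ p ∣ n) : v (n : K) = 0 := by
  by_contra hne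
  have hpos : 0 < v (n : K) := lt_of_le_of_ne (aux_nat v n) (Ne.symm hne)
  have hc : IsCoprime (p : ℤ) (n : ℤ) :=
    Nat.isCoprime_iff_coprime.mpr ((Nat.Prime.coprime_iff_not_dvd hp).mpr h)
  obtain ⟨s, t, hst⟩ := hc
  have h1 : (s : K) * (p : K) + (t : K) * (n : K) = 1 := by exact_mod_cast congrArg (Int.cast : ℤ → K) hst
  have h2 : 0 < v ((s : K) * (p : K) + (t : K) * (n : K)) := by
    apply v.map_lt_add
    · rw [v.map_mul, hvp]
      exact lt_of_lt_of_le (by norm_num) (le_add_of_nonneg_left (aux_int v s))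
    · rw [v.map_mul]
      exact lt_of_lt_of_le hpos (le_add_of_nonneg_left (aux_int v t))
  rw [h1, v.map_one] at h2
  exact lt_irrefl _ h2

theorem aux_pow {K : Type*} [Field K] (v : AddValuation K (WithTop ℤ)) (p k : ℕ)
    (hvp : v (p : K) = 1) : v ((p : K) ^ k) = ((k : ℤ) : WithTop ℤ) := by
  rw [v.map_pow, hvp]
  simp

/-- Lemma 1.3(b) of Lorenzini–Tucker: if `p ∤ I + 1` then `J ≤ I`. -/
theorem stmt1 (p : ℕ) (hp : p.Prime) (hp2 : 2 < p)
    (K : Type*) [Field K] [CharZero K]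
    (v : AddValuation K (WithTop ℤ)) (hvp : v (p : K) = 1)
    (a : ℕ → K) (ha : ∀ m, 0 ≤ v (a m)) (ha0 : ∃ m, v (a m) = 0)
    (c : ℕ → K) (hc0 : c 0 = a 0)
    (hc : ∀ m, 1 ≤ m → c m = a m * (p : K) ^ m / (m : K))
    (I : ℕ) (hI : I = sInf {m | v (a m) = 0})
    (hIbound : I < p ^ 2 - 2) (hdvd : ¬ p ∣ I + 1) :
    {m : ℕ | ∀ ℓ, m < ℓ → v (c m) < v (c ℓ)}.Nonempty ∧
      sInf {m : ℕ | ∀ ℓ, m < ℓ → v (c m) < v (c ℓ)} ≤ I := by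
  have haI : v (a I) = 0 := by
    have := Nat.sInf_mem (s := {m | v (a m) = 0}) ha0
    rw [← hI] at this
    exact this
  have key : ∀ m, 1 ≤ m → v (c m) + v (m : K) = v (a m) + ((m : ℤ) : WithTop ℤ) := by
    intro m hm
    have hm0 : (m : K) ≠ 0 := by exact_mod_cast (by omega : m ≠ 0)
    rw [← v.map_mul, hc m hm, div_mul_cancel₀ _ hm0, v.map_mul, aux_pow v p m hvp]
  have hcI : v (c I) ≤ ((I : ℤ) : WithTop ℤ) := by
    rcases Nat.eq_zero_or_pos I with h0 | h0
    · have : c I = a I := by rw [h0]; exact hc0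
      rw [this, haI, h0]; simp
    · have := key I h0
      rw [haI, zero_add] at this
      rw [← this]
      exact le_add_of_nonneg_right (aux_nat v I)
  have hmem : I ∈ {m : ℕ | ∀ ℓ, m < ℓ → v (c m) < v (c ℓ)} := by
    intro l hl
    refine lt_of_le_of_lt hcI ?_
    obtain ⟨k, n, hn, hkn⟩ := Nat.exists_eq_pow_mul_and_not_dvd (n := l) (by omega) p hp.ne_one
    have hvl : v (l : K) = ((k : ℤ) : WithTop ℤ) := by
      rw [hkn]; push_cast
      rw [v.map_mul, aux_pow v p k hvp, aux_cop v p n hp hvp hn, add_zero]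
      rfl
    have hlt : I + k < l := by
      have hn0 : 1 ≤ n := by
        rcases Nat.eq_zero_or_pos n with h | h
        · exact absurd (h ▸ dvd_zero p) hn
        · exact h
      rcases k with _ | _ | k
      · omega
      · have : l ≠ I + 1 := by
          rintro rfl
          exact hdvd ⟨n, by simpa using hkn⟩
        omega
      · have h1 : p ^ 2 + k ≤ p ^ (k + 2) := by
          clear hkn hvl
          induction k with
          | zero => simp
          | succ j ih =>
            have : p ^ (j + 1 + 2) = p ^ (j + 2) * p := by ring
            nlinarith [Nat.pow_pos (n := j + 2) hp.pos]
        have h2 : p ^ (k + 2) ≤ l := by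
          rw [hkn]; exact Nat.le_mul_of_pos_right _ hn0
        omega
    have h := key l (by omega)
    have hal := ha l
    rw [hvl] at h
    have h3 : ((l : ℤ) : WithTop ℤ) ≤ v (c l) + ((k : ℤ) : WithTop ℤ) := by
      rw [h]; exact le_add_of_nonneg_left hal
    generalize v (c l) = x at h3
    induction x using WithTop.recTopCoe with
    | top => exact WithTop.coe_lt_top _
    | coe x =>
      rw [← WithTop.coe_add, WithTop.coe_le_coe] at h3
      rw [WithTop.coe_lt_coe]
      omega
  exact ⟨⟨I, hmem⟩, Nat.sInf_le hmem⟩
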